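/- Define the two-hidden-layer GCN output with a jumping connection by outₙ(X, A¹, A²; W, V) = C σ(W equal X a¹ₙ) + C σ(V C σ(W X A¹) a²ₙ), where a¹ₙ and a²ₙ are the n-th columns of A¹ and A² respectively; here outₙ(X, A*, A*; W, V) uses A* in both layers. Suppose X ∈ ℝ^{d×N} has all columns of Euclidean norm at most 1, ‖C‖₂ ≤ 1, ‖W‖₂ ≤ τ_w and ‖V‖₂ ≤ τ_v. Then for every n, ‖outₙ(X, A¹, A²; W, V) − outₙ(X, A*, A*; W, V)‖₂ ≤ τ_w ‖A¹ − A*‖₁ + τ_v τ_w ( (‖A*‖₁ + ‖A¹ − A*‖₁) ‖A² − A*‖₁ + ‖A¹ − A*‖₁ ‖A*‖₁ ). In particular, when τ_v < 1 the same output error tolerates a proportionally larger deviation ‖A² − A*‖₁ in the second layer than ‖A¹ − A*‖₁ in the first layer. -/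

import Mathlib

open scoped BigOperators

/-- Euclidean (ℓ2) norm of a finite real vector. -/
noncomputable def l2norm {n : ℕ} (v : Fin n → ℝ) : ℝ := Real.sqrt (∑ i, (v i) ^ 2)

/-- Maximum absolute column sum of a matrix (the ℓ1-induced operator norm). -/
noncomputable def colNorm {m n : ℕ} (M : Matrix (Fin m) (Fin n) ℝ) : ℝ :=
  ⨆ j, ∑ i, |M i j|

/-- Spectral norm (ℓ2-induced operator norm) of a matrix. -/
noncomputable def specNorm {m n : ℕ} (M : Matrix (Fin m) (Fin n) ℝ) : ℝ :=
  ⨆ v : {v : Fin n → ℝ // l2norm v ≤ 1}, l2norm (M.mulVec v.1)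

/-- Entrywise ReLU on vectors. -/
def reluV {n : ℕ} (v : Fin n → ℝ) : Fin n → ℝ := fun i => max (v i) 0

/-- Entrywise ReLU on matrices. -/
def reluM {m n : ℕ} (M : Matrix (Fin m) (Fin n) ℝ) : Matrix (Fin m) (Fin n) ℝ :=
  Matrix.of fun i j => max (M i j) 0

/-- Two-hidden-layer GCN output with a jumping connection at node `n`:
`outₙ(X, A¹, A²; W, V) = C σ(W X a¹ₙ) + C σ(V C σ(W X A¹) a²ₙ)`. -/
noncomputable def gcnOut {d N m k : ℕ} (X : Matrix (Fin d) (Fin N) ℝ)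
    (A1 A2 : Matrix (Fin N) (Fin N) ℝ)
    (W : Matrix (Fin m) (Fin d) ℝ) (V : Matrix (Fin m) (Fin k) ℝ)
    (C : Matrix (Fin k) (Fin m) ℝ) (n : Fin N) : Fin k → ℝ :=
  C.mulVec (reluV (W.mulVec (X.mulVec (fun i => A1 i n)))) +
    C.mulVec (reluV (V.mulVec ((C * reluM (W * X * A1)).mulVec (fun i => A2 i n))))

lemma l2norm_eq_norm {n : ℕ} (v : Fin n → ℝ) : l2norm v = ‖WithLp.toLp 2 v‖ := by
  simp [l2norm, EuclideanSpace.norm_eq]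

lemma l2norm_nonneg {n : ℕ} (v : Fin n → ℝ) : 0 ≤ l2norm v := Real.sqrt_nonneg _

lemma l2norm_add_le {n : ℕ} (u v : Fin n → ℝ) : l2norm (u + v) ≤ l2norm u + l2norm v := by
  simpa only [l2norm_eq_norm, WithLp.toLp_add] using norm_add_le _ _

lemma l2norm_smul {n : ℕ} (c : ℝ) (v : Fin n → ℝ) : l2norm (c • v) = |c| * l2norm v := by
  rw [l2norm_eq_norm, l2norm_eq_norm, WithLp.toLp_smul, norm_smul, Real.norm_eq_abs]

lemma l2norm_sum_le {ι : Type*} {n : ℕ} (s : Finset ι) (f : ι → Fin n → ℝ) :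
    l2norm (∑ j ∈ s, f j) ≤ ∑ j ∈ s, l2norm (f j) := by
  simpa only [l2norm_eq_norm, WithLp.toLp_sum] using norm_sum_le _ _

lemma l2norm_le_of_abs_le {n : ℕ} {u v : Fin n → ℝ} (h : ∀ i, |u i| ≤ |v i|) :
    l2norm u ≤ l2norm v :=
  Real.sqrt_le_sqrt (Finset.sum_le_sum fun i _ => sq_le_sq.mpr (h i))

lemma l2norm_reluV_le {n : ℕ} (v : Fin n → ℝ) : l2norm (reluV v) ≤ l2norm v :=
  l2norm_le_of_abs_le fun i => by
    simpa [reluV] using abs_max_sub_max_le_abs (v i) 0 0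

lemma l2norm_reluV_sub_le {n : ℕ} (u v : Fin n → ℝ) :
    l2norm (reluV u - reluV v) ≤ l2norm (u - v) :=
  l2norm_le_of_abs_le fun i => abs_max_sub_max_le_abs (u i) (v i) 0

lemma bddAbove_range_specNorm {m n : ℕ} (M : Matrix (Fin m) (Fin n) ℝ) :
    BddAbove (Set.range fun v : {v : Fin n → ℝ // l2norm v ≤ 1} => l2norm (M.mulVec v.1)) := by
  set L := (Matrix.toEuclideanLin M).toContinuousLinearMap
  refine ⟨‖L‖, ?_⟩
  rintro _ ⟨⟨v, hv⟩, rfl⟩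
  rw [l2norm_eq_norm] at hv
  have h := L.le_of_opNorm_le_of_le le_rfl hv
  simpa [l2norm_eq_norm, L, Matrix.toLpLin_toLp] using h

lemma specNorm_nonneg {m n : ℕ} (M : Matrix (Fin m) (Fin n) ℝ) : 0 ≤ specNorm M :=
  Real.iSup_nonneg fun _ => l2norm_nonneg _

lemma l2norm_mulVec_le_specNorm {m n : ℕ} (M : Matrix (Fin m) (Fin n) ℝ) (v : Fin n → ℝ) :
    l2norm (M.mulVec v) ≤ specNorm M * l2norm v := by
  rcases (l2norm_nonneg v).eq_or_lt with h | h
  · have hv : v = 0 := by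
      rw [l2norm_eq_norm, eq_comm, norm_eq_zero] at h
      simpa using h
    simp [hv, l2norm]
  · have hunit : l2norm ((l2norm v)⁻¹ • v) ≤ 1 := by
      rw [l2norm_smul, abs_of_pos (inv_pos.mpr h), inv_mul_cancel₀ h.ne']
    have hle : l2norm (M.mulVec ((l2norm v)⁻¹ • v)) ≤ specNorm M :=
      le_ciSup (bddAbove_range_specNorm M) ⟨_, hunit⟩
    rwa [Matrix.mulVec_smul, l2norm_smul, abs_of_pos (inv_pos.mpr h), inv_mul_le_iff₀ h,
      mul_comm] at hle

lemma l2norm_mulVec_le {m n : ℕ} {M : Matrix (Fin m) (Fin n) ℝ} {t : ℝ} (hM : specNorm M ≤ t)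
    (v : Fin n → ℝ) : l2norm (M.mulVec v) ≤ t * l2norm v :=
  (l2norm_mulVec_le_specNorm M v).trans (mul_le_mul_of_nonneg_right hM (l2norm_nonneg v))

lemma sum_abs_le_colNorm {m n : ℕ} (M : Matrix (Fin m) (Fin n) ℝ) (j : Fin n) :
    ∑ i, |M i j| ≤ colNorm M :=
  le_ciSup (f := fun j => ∑ i, |M i j|) (Set.finite_range _).bddAbove j

lemma colNorm_nonneg {m n : ℕ} (M : Matrix (Fin m) (Fin n) ℝ) : 0 ≤ colNorm M :=
  Real.iSup_nonneg fun _ => Finset.sum_nonneg fun _ _ => abs_nonneg _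

lemma colNorm_le_add_colNorm_sub {m n : ℕ} (M M' : Matrix (Fin m) (Fin n) ℝ) :
    colNorm M ≤ colNorm M' + colNorm (M - M') := by
  refine Real.iSup_le (fun j => ?_) (add_nonneg (colNorm_nonneg _) (colNorm_nonneg _))
  calc ∑ i, |M i j| ≤ ∑ i, (|M' i j| + |(M - M') i j|) := Finset.sum_le_sum fun i _ => by
        simpa using abs_add_le (M' i j) ((M - M') i j)
    _ ≤ _ := by
        rw [Finset.sum_add_distrib]
        exact add_le_add (sum_abs_le_colNorm M' j) (sum_abs_le_colNorm (M - M') j)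

/-- If the columns of `M` have Euclidean norm at most `B`, then so has `M`, as an operator from
`ℓ1` to `ℓ2`; here it is applied to a column of `A`. -/
lemma l2norm_mulVec_col_le {m n p : ℕ} {M : Matrix (Fin m) (Fin n) ℝ} {B : ℝ} (hB : 0 ≤ B)
    (hM : ∀ j, l2norm (fun i => M i j) ≤ B) (A : Matrix (Fin n) (Fin p) ℝ) (l : Fin p) :
    l2norm (M.mulVec (fun i => A i l)) ≤ B * colNorm A := by
  have hsum : M.mulVec (fun i => A i l) = ∑ j, A j l • (fun i => M i j) := by
    ext i
    simp [Matrix.mulVec, dotProduct, mul_comm]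
  calc l2norm (M.mulVec (fun i => A i l)) ≤ ∑ j, l2norm (A j l • (fun i => M i j)) :=
        hsum ▸ l2norm_sum_le _ _
    _ ≤ ∑ j, |A j l| * B := Finset.sum_le_sum fun j _ => by
        rw [l2norm_smul]
        exact mul_le_mul_of_nonneg_left (hM j) (abs_nonneg _)
    _ = B * ∑ j, |A j l| := by rw [← Finset.sum_mul, mul_comm]
    _ ≤ B * colNorm A := mul_le_mul_of_nonneg_left (sum_abs_le_colNorm A l) hB

lemma reluM_col {d N m p : ℕ} (W : Matrix (Fin m) (Fin d) ℝ) (X : Matrix (Fin d) (Fin N) ℝ)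
    (A : Matrix (Fin N) (Fin p) ℝ) (j : Fin p) :
    (fun i => reluM (W * X * A) i j) = reluV (W.mulVec (X.mulVec fun i => A i j)) := by
  rw [Matrix.mulVec_mulVec]
  rfl

theorem stmt_3 {d N m k : ℕ} (X : Matrix (Fin d) (Fin N) ℝ)
    (hX : ∀ j : Fin N, l2norm (fun i => X i j) ≤ 1)
    (W : Matrix (Fin m) (Fin d) ℝ) (V : Matrix (Fin m) (Fin k) ℝ)
    (C : Matrix (Fin k) (Fin m) ℝ)
    (τw τv : ℝ) (hC : specNorm C ≤ 1) (hW : specNorm W ≤ τw) (hV : specNorm V ≤ τv)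
    (A1 A2 Astar : Matrix (Fin N) (Fin N) ℝ) :
    ∀ n : Fin N,
      l2norm (gcnOut X A1 A2 W V C n - gcnOut X Astar Astar W V C n) ≤
        τw * colNorm (A1 - Astar) +
          τv * τw *
            ((colNorm Astar + colNorm (A1 - Astar)) * colNorm (A2 - Astar) +
              colNorm (A1 - Astar) * colNorm Astar) := by
  intro n
  have hτw : 0 ≤ τw := (specNorm_nonneg W).trans hW
  have hτv : 0 ≤ τv := (specNorm_nonneg V).trans hV
  have hXA (A : Matrix (Fin N) (Fin N) ℝ) (j : Fin N) :
      l2norm (W.mulVec (X.mulVec fun i => A i j)) ≤ τw * colNorm A :=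
    (l2norm_mulVec_le hW _).trans <| mul_le_mul_of_nonneg_left
      (by simpa using l2norm_mulVec_col_le zero_le_one hX A j) hτw
  have hrelu_sub (j : Fin N) :
      l2norm (reluV (W.mulVec (X.mulVec fun i => A1 i j)) -
        reluV (W.mulVec (X.mulVec fun i => Astar i j))) ≤ τw * colNorm (A1 - Astar) := by
    refine (l2norm_reluV_sub_le _ _).trans ?_
    rw [← Matrix.mulVec_sub, ← Matrix.mulVec_sub]
    exact hXA (A1 - Astar) j
  have hC1 (v : Fin m → ℝ) : l2norm (C.mulVec v) ≤ l2norm v := by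
    simpa using l2norm_mulVec_le hC v
  set H1 := reluM (W * X * A1) with hH1
  set Hs := reluM (W * X * Astar) with hHs
  have hcol1 (j : Fin N) :
      l2norm (fun i => H1 i j) ≤ τw * (colNorm Astar + colNorm (A1 - Astar)) := by
    rw [hH1, reluM_col]
    exact (l2norm_reluV_le _).trans ((hXA A1 j).trans
      (mul_le_mul_of_nonneg_left (colNorm_le_add_colNorm_sub A1 Astar) hτw))
  have hcol2 (j : Fin N) : l2norm (fun i => (H1 - Hs) i j) ≤ τw * colNorm (A1 - Astar) := by
    have h := hrelu_sub j
    rwa [← reluM_col, ← reluM_col] at h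
  have hδ1 := colNorm_nonneg (A1 - Astar)
  have hhidden : l2norm (H1.mulVec (fun i => A2 i n) - Hs.mulVec (fun i => Astar i n)) ≤
      τw * (colNorm Astar + colNorm (A1 - Astar)) * colNorm (A2 - Astar) +
        τw * colNorm (A1 - Astar) * colNorm Astar := by
    have hsplit : H1.mulVec (fun i => A2 i n) - Hs.mulVec (fun i => Astar i n) =
        H1.mulVec (fun i => (A2 - Astar) i n) + (H1 - Hs).mulVec (fun i => Astar i n) := by
      rw [Matrix.sub_mulVec, show (fun i => (A2 - Astar) i n) =
        (fun i => A2 i n) - fun i => Astar i n from rfl, Matrix.mulVec_sub]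
      abel
    rw [hsplit]
    exact (l2norm_add_le _ _).trans (add_le_add
      (l2norm_mulVec_col_le (mul_nonneg hτw (add_nonneg (colNorm_nonneg _) hδ1)) hcol1 _ n)
      (l2norm_mulVec_col_le (mul_nonneg hτw hδ1) hcol2 _ n))
  have hout : gcnOut X A1 A2 W V C n - gcnOut X Astar Astar W V C n =
      C.mulVec (reluV (W.mulVec (X.mulVec fun i => A1 i n)) -
        reluV (W.mulVec (X.mulVec fun i => Astar i n))) +
      C.mulVec (reluV (V.mulVec (C.mulVec (H1.mulVec fun i => A2 i n))) -
        reluV (V.mulVec (C.mulVec (Hs.mulVec fun i => Astar i n)))) := by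
    simp only [gcnOut, Matrix.mulVec_sub, ← Matrix.mulVec_mulVec, hH1, hHs]
    abel
  rw [hout]
  refine (l2norm_add_le _ _).trans (add_le_add ((hC1 _).trans (hrelu_sub n)) ?_)
  refine (hC1 _).trans ((l2norm_reluV_sub_le _ _).trans ?_)
  rw [← Matrix.mulVec_sub, ← Matrix.mulVec_sub]
  refine (l2norm_mulVec_le hV _).trans
    ((mul_le_mul_of_nonneg_left ((hC1 _).trans hhidden) hτv).trans_eq ?_)
  ring
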